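/- Let χ = 0 and let S be the (p-1)-dimensional simple restricted W-module. Then Ext(S, S) = 0 in the category of restricted W-modules; that is, every short exact sequence 0 → S → M → S → 0 of restricted W-modules splits. -/

import Mathlib

/-!
Common setup: the Witt algebra `W` over `K` (char `p > 3`) has basis
`e_{-1}, e_0, ..., e_{p-2}` with `[e_i, e_j] = (j-i) e_{i+j}` (and `e_k = 0`
outside the range), and `p`-mapping `e_i^{[p]} = δ_{i0} e_i`.  A module with
`p`-character `χ` over `W` (resp. the subalgebra `W_0 = <e_0, ..., e_{p-2}>`)
is given by a family of endomorphisms `ρ k` (`k : ℤ`, vanishing outside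
`[lo, p-2]` where `lo = -1` for `W` and `lo = 0` for `W_0`) satisfying the
bracket relations and `(ρ i)^p - δ_{i0} ρ i = χ(e_i)^p • 1`.

The Baer Ext space `Ext(N, M)` of two such modules, in the category of
modules with `p`-character `χ`, is realized concretely: an extension
`0 → M → E → N → 0` admits a linear splitting `E ≃ M ⊕ N`, under which the
action of `e_k` is `(m, n) ↦ (ρM k m + c k n, ρN k n)` for a "cocycle"
`c : ℤ → (N →ₗ M)`; the conditions for `E` to be a module with `p`-character
`χ` are the cocycle conditions below, Baer equivalence corresponds to
differing by a coboundary, and the Baer sum / scalar action correspond to the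
linear structure on cocycles.  So `Ext(N, M) ≅ cocycles / coboundaries`.
-/

set_option maxHeartbeats 1000000
set_option synthInstance.maxHeartbeats 1000000

noncomputable section

/-- The coefficient `(-1)^j · (i!/(i-j)!) · ((j+1)λ - i + j)` of the action
`e_j · v_i = (coefficient) · v_{i-j}` on the reduced Verma module; it vanishes
for `j > i` since then `Nat.descFactorial i j = 0`. -/
def wCoef (K : Type) [Field K] (lam : K) (j i : ℕ) : K :=
  (-1 : K) ^ j * (Nat.descFactorial i j : K) * (((j : K) + 1) * lam - (i : K) + (j : K))

/-- Matrices (in the basis `v_0, ..., v_{p-1}`) of the generators `e_j`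
(`j : ℤ`) acting on the reduced Verma module `V_χ(λ)`; here `c = χ(e_{-1})^p`.
`e_{-1} v_i = v_{i+1}` for `i < p-1`, `e_{-1} v_{p-1} = c v_0`, and for
`0 ≤ j ≤ p-2`, `e_j v_i = (-1)^j (i!/(i-j)!) ((j+1)λ - i + j) v_{i-j}`. -/
def vermaMat (K : Type) [Field K] (p : ℕ) (c lam : K) : ℤ → Matrix (Fin p) (Fin p) K :=
  fun j =>
    if j = -1 then
      Matrix.of fun k l =>
        if (k : ℕ) = (l : ℕ) + 1 then 1
        else if (k : ℕ) = 0 ∧ (l : ℕ) = p - 1 then c else 0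
    else if 0 ≤ j ∧ j ≤ (p : ℤ) - 2 then
      Matrix.of fun k l =>
        if (l : ℕ) = (k : ℕ) + j.toNat then wCoef K lam j.toNat (l : ℕ) else 0
    else 0

/-- The action of the basis elements `e_j` (`j : ℤ`) on the reduced Verma
module `V_χ(λ)`, with `c = χ(e_{-1})^p`. -/
def vermaRho (K : Type) [Field K] (p : ℕ) (c lam : K) : ℤ → Module.End K (Fin p → K) :=
  fun j => Matrix.toLin' (vermaMat K p c lam j)

/-- The one-dimensional `W_0`-module `K_λ`: `e_0` acts by `λ`, all other `e_j` act by `0`. -/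
def oneDimRho (K : Type) [Field K] (lam : K) : ℤ → Module.End K K :=
  fun j => if j = 0 then lam • (1 : Module.End K K) else 0

/-- The one-dimensional trivial module: every basis element acts by `0`. -/
def trivRho (K : Type) [Field K] : ℤ → Module.End K K := fun _ => 0

/-- The coefficient `(-1)^(j+1) · ((i+1)!/(i-j)!)` of the action
`e_j · u_i = (coefficient) · u_{i-j}` on the `(p-1)`-dimensional simple module `S`. -/
def sCoef (K : Type) [Field K] (j i : ℕ) : K :=
  (-1 : K) ^ (j + 1) * (Nat.descFactorial (i + 1) (j + 1) : K)

/-- Matrices (in the basis `u_0, ..., u_{p-2}`) of the generators `e_j` acting on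
the `(p-1)`-dimensional simple restricted module `S = V_0(p-1)/Soc(V_0(p-1))`. -/
def sMat (K : Type) [Field K] (p : ℕ) : ℤ → Matrix (Fin (p - 1)) (Fin (p - 1)) K :=
  fun j =>
    if j = -1 then
      Matrix.of fun k l => if (k : ℕ) = (l : ℕ) + 1 then 1 else 0
    else if 0 ≤ j ∧ j ≤ (p : ℤ) - 2 then
      Matrix.of fun k l =>
        if (l : ℕ) = (k : ℕ) + j.toNat then sCoef K j.toNat (l : ℕ) else 0
    else 0

/-- The action of the basis elements `e_j` on the simple module `S`. -/
def sRho (K : Type) [Field K] (p : ℕ) : ℤ → Module.End K (Fin (p - 1) → K) :=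
  fun j => Matrix.toLin' (sMat K p j)

section ExtSpace

variable (K : Type) [Field K] (M N : Type) [AddCommGroup M] [Module K M]
  [AddCommGroup N] [Module K N]

/-- Constraint: a cocycle vanishes outside the index range `[lo, p-2]`. -/
def suppConstraint (p : ℕ) (lo k : ℤ) : (ℤ → N →ₗ[K] M) →ₗ[K] (N →ₗ[K] M) :=
  if k < lo ∨ (p : ℤ) - 2 < k then LinearMap.proj k else 0

variable {M N}

/-- Constraint on a cocycle coming from the bracket relation
`[e_i, e_j] = (j - i) e_{i+j}`:
`(j-i) c(i+j) = ρM i ∘ c j + c i ∘ ρN j - ρM j ∘ c i - c j ∘ ρN i`. -/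
def bracketConstraint (p : ℕ) (lo : ℤ) (ρM : ℤ → Module.End K M)
    (ρN : ℤ → Module.End K N) (i j : ℤ) :
    (ℤ → N →ₗ[K] M) →ₗ[K] (N →ₗ[K] M) :=
  if lo ≤ i ∧ i ≤ (p : ℤ) - 2 ∧ lo ≤ j ∧ j ≤ (p : ℤ) - 2 then
    ((j - i : ℤ) : K) • LinearMap.proj (i + j)
      - LinearMap.llcomp K N M M (ρM i) ∘ₗ LinearMap.proj j
      - LinearMap.lcomp K M (ρN j) ∘ₗ LinearMap.proj i
      + LinearMap.llcomp K N M M (ρM j) ∘ₗ LinearMap.proj i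
      + LinearMap.lcomp K M (ρN i) ∘ₗ LinearMap.proj j
  else 0

/-- Constraint on a cocycle expressing that the extension has `p`-character `χ`:
on the extension `E = M ⊕ N` the `(N → M)`-component of `(e_i)^p` is
`∑_{k<p} (ρM i)^k ∘ c i ∘ (ρN i)^(p-1-k)`, and this must agree with the
`(N → M)`-component of `e_i^{[p]} + χ(e_i)^p • 1`, which is `δ_{i0} c i`
(the scalar `χ(e_i)^p` contributes nothing off the diagonal, and the diagonal
blocks hold since `M`, `N` have `p`-character `χ`). -/
def pcharConstraint (p : ℕ) (lo : ℤ) (ρM : ℤ → Module.End K M)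
    (ρN : ℤ → Module.End K N) (i : ℤ) :
    (ℤ → N →ₗ[K] M) →ₗ[K] (N →ₗ[K] M) :=
  if lo ≤ i ∧ i ≤ (p : ℤ) - 2 then
    (∑ k ∈ Finset.range p,
        LinearMap.llcomp K N M M ((ρM i) ^ k) ∘ₗ
          LinearMap.lcomp K M ((ρN i) ^ (p - 1 - k)) ∘ₗ LinearMap.proj i)
      - (if i = 0 then (LinearMap.proj 0 : (ℤ → N →ₗ[K] M) →ₗ[K] (N →ₗ[K] M)) else 0)
  else 0

/-- The space of cocycles: families `c : ℤ → (N →ₗ M)` (the values of a linear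
map `W → Hom(N, M)` on the basis, `lo = -1` for `W` and `lo = 0` for `W_0`)
such that `M ⊕ N` with action `e_k (m, n) = (ρM k m + c k n, ρN k n)` is a
module with `p`-character `χ`. -/
def cocycles (p : ℕ) (lo : ℤ) (ρM : ℤ → Module.End K M) (ρN : ℤ → Module.End K N) :
    Submodule K (ℤ → N →ₗ[K] M) :=
  (⨅ k : ℤ, LinearMap.ker (suppConstraint K M N p lo k)) ⊓
    (⨅ i : ℤ, ⨅ j : ℤ, LinearMap.ker (bracketConstraint K p lo ρM ρN i j)) ⊓
    (⨅ i : ℤ, LinearMap.ker (pcharConstraint K p lo ρM ρN i))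

/-- The coboundaries: cocycles of the form `k ↦ ρM k ∘ f - f ∘ ρN k` for a
linear map `f : N → M`; these are exactly the cocycles of split extensions,
and two cocycles give Baer-equivalent extensions iff they differ by a
coboundary. -/
def coboundaries (p : ℕ) (lo : ℤ) (ρM : ℤ → Module.End K M) (ρN : ℤ → Module.End K N) :
    Submodule K (ℤ → N →ₗ[K] M) :=
  LinearMap.range (LinearMap.pi fun k : ℤ =>
    if lo ≤ k ∧ k ≤ (p : ℤ) - 2 then
      LinearMap.llcomp K N M M (ρM k) - LinearMap.lcomp K M (ρN k)
    else 0)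

/-- The Baer Ext space `Ext(N, M)` in the category of modules with
`p`-character `χ` (over `W` if `lo = -1`, over `W_0` if `lo = 0`), realized
as cocycles modulo coboundaries. -/
abbrev extSpace (p : ℕ) (lo : ℤ) (ρM : ℤ → Module.End K M) (ρN : ℤ → Module.End K N) :=
  (cocycles K p lo ρM ρN) ⧸
    (Submodule.comap (cocycles K p lo ρM ρN).subtype (coboundaries K p lo ρM ρN))

end ExtSpace

end

section SimpleModule

variable (K : Type) [Field K] (p : ℕ)

/-- The basis vector `u_i` of `S`, with `u_i = 0` for `i ≥ p - 1`. -/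
def sBasis (i : ℕ) : Fin (p - 1) → K := fun k => if (k : ℕ) = i then 1 else 0

variable {K p}

theorem sBasis_apply (i : ℕ) (a : Fin (p - 1)) :
    sBasis K p i a = if (a : ℕ) = i then 1 else 0 := rfl

theorem sBasis_eq_zero {i : ℕ} (hi : p - 1 ≤ i) : sBasis K p i = 0 := by
  funext k
  have := k.2
  rw [sBasis_apply, if_neg (by omega), Pi.zero_apply]

theorem sBasis_eq_single (i : Fin (p - 1)) : sBasis K p i = Pi.single i 1 := by
  funext k
  simp [sBasis_apply, Pi.single_apply, Fin.ext_iff]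

theorem ext_sBasis {V : Type} [AddCommGroup V] [Module K V] {f g : (Fin (p - 1) → K) →ₗ[K] V}
    (h : ∀ i, f (sBasis K p i) = g (sBasis K p i)) : f = g := by
  refine LinearMap.pi_ext' fun i => LinearMap.ext_ring ?_
  simpa [sBasis_eq_single] using h i

theorem toLin'_sBasis (A : Matrix (Fin (p - 1)) (Fin (p - 1)) K) (i a : Fin (p - 1)) :
    Matrix.toLin' A (sBasis K p i) a = A a i := by
  rw [sBasis_eq_single, Matrix.toLin'_apply, Matrix.mulVec_single_one, Matrix.col_apply]

theorem sRho_neg_one (i : ℕ) : sRho K p (-1) (sBasis K p i) = sBasis K p (i + 1) := by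
  by_cases hi : i < p - 1
  · funext a
    have := toLin'_sBasis (sMat K p (-1)) ⟨i, hi⟩ a
    rw [sRho, this, sMat, if_pos rfl, Matrix.of_apply, sBasis_apply]
  · rw [sBasis_eq_zero (by omega), sBasis_eq_zero (by omega), map_zero]

theorem dvd_descFactorial_of_le {n k : ℕ} (hp : p.Prime) (hn : p ≤ n) (hk : n < p + k) :
    p ∣ n.descFactorial k := by
  by_cases hkn : k ≤ n
  · have h : p ∣ (n - k).factorial * n.descFactorial k := by
      rw [Nat.factorial_mul_descFactorial hkn]
      exact hp.dvd_factorial.2 hn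
    refine (hp.dvd_mul.1 h).resolve_left fun h' => ?_
    have := hp.dvd_factorial.1 h'
    omega
  · simp [Nat.descFactorial_eq_zero_iff_lt.2 (not_le.1 hkn)]

theorem dvd_descFactorial_of_le_right {n k : ℕ} (hp : p.Prime) (hk : p ≤ k) :
    p ∣ n.descFactorial k :=
  (hp.dvd_factorial.2 hk).trans (Nat.factorial_dvd_descFactorial n k)

theorem sCoef_eq_zero [CharP K p] {j i : ℕ} (h : p ∣ (i + 1).descFactorial (j + 1)) :
    sCoef K j i = 0 := by
  rw [sCoef, (CharP.cast_eq_zero_iff K p _).2 h, mul_zero]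

theorem sCoef_eq_zero_of_lt {j i : ℕ} (h : i < j) : sCoef K j i = 0 := by
  rw [sCoef, Nat.descFactorial_eq_zero_iff_lt.2 (by omega), Nat.cast_zero, mul_zero]

theorem sRho_natCast [CharP K p] (hp : p.Prime) (j i : ℕ) :
    sRho K p j (sBasis K p i) = sCoef K j i • sBasis K p (i - j) := by
  have h1 : ((j : ℤ) ≠ -1) := by omega
  by_cases hj : j ≤ p - 2
  · have h2 : 0 ≤ (j : ℤ) ∧ (j : ℤ) ≤ (p : ℤ) - 2 := by
      have := hp.two_le
      omega
    by_cases hi : i < p - 1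
    · funext a
      have := toLin'_sBasis (sMat K p j) ⟨i, hi⟩ a
      rw [sRho, this, sMat, if_neg h1, if_pos h2]
      simp only [Matrix.of_apply, Int.toNat_natCast, Pi.smul_apply, sBasis_apply, smul_eq_mul,
        mul_ite, mul_one, mul_zero]
      by_cases hij : j ≤ i
      · simp only [show (i = (a : ℕ) + j) ↔ ((a : ℕ) = i - j) by omega]
      · rw [if_neg (by omega), sCoef_eq_zero_of_lt (by omega), ite_self]
    · rw [sBasis_eq_zero (by omega), map_zero]
      by_cases hij : i - j < p - 1
      · rw [sCoef_eq_zero (dvd_descFactorial_of_le hp (by omega) (by omega)), zero_smul]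
      · rw [sBasis_eq_zero (by omega), smul_zero]
  · have h2 : ¬(0 ≤ (j : ℤ) ∧ (j : ℤ) ≤ (p : ℤ) - 2) := by omega
    rw [sRho, sMat, if_neg h1, if_neg h2,
      sCoef_eq_zero (dvd_descFactorial_of_le_right hp (by omega))]
    simp

theorem sRho_zero [CharP K p] (hp : p.Prime) (i : ℕ) :
    sRho K p 0 (sBasis K p i) = (-((i : K) + 1)) • sBasis K p i := by
  simpa [sCoef] using sRho_natCast (K := K) hp 0 i

theorem sRho_one [CharP K p] (hp : p.Prime) (i : ℕ) :
    sRho K p 1 (sBasis K p i) = (((i : K) + 1) * i) • sBasis K p (i - 1) := by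
  simpa [sCoef, Nat.descFactorial_succ, mul_comm] using sRho_natCast (K := K) hp 1 i

theorem sRho_two_succ [CharP K p] (hp : p.Prime) (i : ℕ) :
    sRho K p 2 (sBasis K p (i + 1)) =
      (-(((i : K) + 2) * (i + 1) * i)) • sBasis K p (i - 1) := by
  have h := sRho_natCast (K := K) hp 2 (i + 1)
  rw [show i + 1 - 2 = i - 1 by omega] at h
  refine h.trans ?_
  congr 1
  simp [sCoef, Nat.descFactorial_succ]
  ring

theorem sRho_zero_apply [CharP K p] (hp : p.Prime) (v : Fin (p - 1) → K) (a : Fin (p - 1)) :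
    sRho K p 0 v a = (-((a : K) + 1)) * v a := by
  have h : LinearMap.proj a ∘ₗ sRho K p 0 =
      (-((a : K) + 1)) • (LinearMap.proj a : (Fin (p - 1) → K) →ₗ[K] K) := by
    refine ext_sBasis fun i => ?_
    simp only [LinearMap.comp_apply, sRho_zero hp, LinearMap.smul_apply, LinearMap.proj_apply,
      Pi.smul_apply, sBasis_apply, smul_eq_mul, mul_ite, mul_one, mul_zero]
    split_ifs with h <;> simp [h]
  exact LinearMap.congr_fun h v

theorem sRho_zero_pow_apply [CharP K p] (hp : p.Prime) (k : ℕ) (v : Fin (p - 1) → K)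
    (a : Fin (p - 1)) : (sRho K p 0 ^ k) v a = (-((a : K) + 1)) ^ k * v a := by
  induction k with
  | zero => simp
  | succ k ih => rw [pow_succ', Module.End.mul_apply, sRho_zero_apply hp, ih, pow_succ', mul_assoc]

theorem sRho_zero_pow_sBasis [CharP K p] (hp : p.Prime) (k i : ℕ) :
    (sRho K p 0 ^ k) (sBasis K p i) = (-((i : K) + 1)) ^ k • sBasis K p i := by
  induction k with
  | zero => simp
  | succ k ih => rw [pow_succ, Module.End.mul_apply, sRho_zero hp, map_smul, ih, smul_smul, pow_succ']

/-- The relation `[e_i, e_j] = (j - i) e_{i+j}` on `S`. -/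
def sBracket (K : Type) [Field K] (p : ℕ) (i j : ℤ) : Prop :=
  ((j - i : ℤ) : K) • sRho K p (i + j) = sRho K p i * sRho K p j - sRho K p j * sRho K p i

theorem sBracket_zero_neg_one [CharP K p] (hp : p.Prime) : sBracket K p 0 (-1) := by
  refine ext_sBasis fun i => ?_
  simp [sRho_neg_one, sRho_zero hp]
  module

theorem sBracket_zero_natCast [CharP K p] (hp : p.Prime) (j : ℕ) : sBracket K p 0 j := by
  refine ext_sBasis fun i => ?_
  by_cases h : i < j
  · simp [sRho_natCast hp, sRho_zero hp, sCoef_eq_zero_of_lt h]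
  · simp [sRho_natCast hp, sRho_zero hp, Nat.cast_sub (not_lt.1 h)]
    module

theorem sBracket_neg_one_one [CharP K p] (hp : p.Prime) : sBracket K p (-1) 1 := by
  refine ext_sBasis fun i => ?_
  cases i with
  | zero =>
    simp [sRho_neg_one, sRho_one hp, sRho_zero hp]
    module
  | succ i =>
    simp [sRho_neg_one, sRho_one hp, sRho_zero hp]
    module

theorem sBracket_neg_one_two [CharP K p] (hp : p.Prime) : sBracket K p (-1) 2 := by
  refine ext_sBasis fun i => ?_
  have h0 : sRho K p 2 (sBasis K p 0) = 0 := by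
    simpa [sCoef] using sRho_natCast (K := K) hp 2 0
  rcases i with _ | _ | i
  · simp [sRho_neg_one, sRho_one hp, sRho_two_succ hp, h0]
  · simp [sRho_neg_one, sRho_one hp, sRho_two_succ hp]
    module
  · simp [sRho_neg_one, sRho_one hp, sRho_two_succ hp]
    module

theorem sBracket_one_natCast [CharP K p] (hp : p.Prime) (j : ℕ) : sBracket K p 1 j := by
  refine ext_sBasis fun i => ?_
  have hc : (1 : ℤ) + j = ((j + 1 : ℕ) : ℤ) := by push_cast; ring
  rw [hc]
  have h1 : i - 1 - j = i - (j + 1) := by omega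
  have h2 : i - j - 1 = i - (j + 1) := by omega
  simp only [LinearMap.smul_apply, LinearMap.sub_apply, Module.End.mul_apply, sRho_natCast hp,
    sRho_one hp, map_smul, smul_smul, h1, h2, ← sub_smul]
  congr 1
  rcases lt_trichotomy i j with h | h | h
  · simp [sCoef_eq_zero_of_lt h, sCoef_eq_zero_of_lt (show i < j + 1 by omega),
      sCoef_eq_zero_of_lt (show i - 1 < j by omega)]
  · subst h
    rcases i with _ | i
    · simp [sCoef]
    · simp [sCoef_eq_zero_of_lt (show i + 1 < i + 1 + 1 by omega),
        sCoef_eq_zero_of_lt (show i < i + 1 by omega)]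
  · obtain ⟨m, rfl⟩ : ∃ m, i = j + 1 + m := ⟨i - (j + 1), by omega⟩
    have e1 : j + 1 + m - j = m + 1 := by omega
    have e2 : j + 1 + m - 1 = j + m := by omega
    have d1 : (j + 1 + m + 1).descFactorial (j + 1 + 1) =
        (m + 1) * (j + 1 + m + 1).descFactorial (j + 1) := by
      rw [Nat.descFactorial_succ]; congr 1; omega
    have d2 : (j + 1 + m + 1) * (j + m + 1).descFactorial (j + 1) =
        (m + 1) * (j + 1 + m + 1).descFactorial (j + 1) := by
      rw [← d1, show j + 1 + m = j + m + 1 by omega]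
      exact (Nat.succ_descFactorial_succ _ _).symm
    have d2' := congrArg (Nat.cast : ℕ → K) d2
    rw [e1, e2]
    simp only [sCoef, d1]
    push_cast at d2' ⊢
    linear_combination (-1 : K) ^ (j + 1) * ((j : K) + 1 + m) * d2'

/-- The coboundary of `f` at `e_k`. -/
def sCob (f : Module.End K (Fin (p - 1) → K)) (k : ℤ) : Module.End K (Fin (p - 1) → K) :=
  sRho K p k * f - f * sRho K p k

/-- The cocycle relation for the pair `(e_i, e_j)`. -/
def cocycleRel (c : ℤ → Module.End K (Fin (p - 1) → K)) (i j : ℤ) : Prop :=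
  ((j - i : ℤ) : K) • c (i + j) =
    sRho K p i * c j + c i * sRho K p j - sRho K p j * c i - c j * sRho K p i

theorem cocycleRel.sub_sCob {c : ℤ → Module.End K (Fin (p - 1) → K)} {i j : ℤ}
    (hc : cocycleRel c i j) (h : sBracket K p i j) (f : Module.End K (Fin (p - 1) → K)) :
    cocycleRel (fun k => c k - sCob f k) i j := by
  unfold cocycleRel sBracket sCob at *
  have : ((j - i : ℤ) : K) • (sRho K p (i + j) * f - f * sRho K p (i + j)) =
      (sRho K p i * sRho K p j - sRho K p j * sRho K p i) * f -
        f * (sRho K p i * sRho K p j - sRho K p j * sRho K p i) := by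
    rw [← h, smul_sub, smul_mul_assoc, mul_smul_comm]
  rw [smul_sub, this, hc]
  simp only [mul_sub, sub_mul, mul_assoc]
  abel

/-- The part of the cocycle conditions that does not mention the `p`-mapping and suffices to
show that a cocycle vanishing on `e_{-1}` and `e_0` is zero. -/
structure IsReducedCocycle (c : ℤ → Module.End K (Fin (p - 1) → K)) : Prop where
  supp : ∀ k : ℤ, k < -1 ∨ (p : ℤ) - 2 < k → c k = 0
  zero_neg_one : cocycleRel c 0 (-1)
  zero_natCast : ∀ j : ℕ, j ≤ 2 → cocycleRel c 0 j
  neg_one_one : cocycleRel c (-1) 1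
  neg_one_two : cocycleRel c (-1) 2
  one_natCast : ∀ j : ℕ, j ≤ p - 2 → cocycleRel c 1 j

theorem sRho_eq_zero {k : ℤ} (hk : k < -1 ∨ (p : ℤ) - 2 < k) (hp : 3 < p) : sRho K p k = 0 := by
  rw [sRho, sMat, if_neg (by omega), if_neg (by omega), map_zero]

theorem IsReducedCocycle.sub_sCob [CharP K p] (hp : p.Prime) (hp3 : 3 < p)
    {c : ℤ → Module.End K (Fin (p - 1) → K)} (hc : IsReducedCocycle c)
    (f : Module.End K (Fin (p - 1) → K)) : IsReducedCocycle (fun k => c k - sCob f k) where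
  supp k hk := by simp [hc.supp k hk, sCob, sRho_eq_zero hk hp3]
  zero_neg_one := hc.zero_neg_one.sub_sCob (sBracket_zero_neg_one hp) f
  zero_natCast j hj := (hc.zero_natCast j hj).sub_sCob (sBracket_zero_natCast hp j) f
  neg_one_one := hc.neg_one_one.sub_sCob (sBracket_neg_one_one hp) f
  neg_one_two := hc.neg_one_two.sub_sCob (sBracket_neg_one_two hp) f
  one_natCast j hj := (hc.one_natCast j hj).sub_sCob (sBracket_one_natCast hp j) f

/-- An operator of weight `j` only has matrix entries from `u_i` to `u_a` with `a ≡ i - j`. -/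
theorem weight_apply [CharP K p] (hp : p.Prime) {c : ℤ → Module.End K (Fin (p - 1) → K)}
    (h0 : c 0 = 0) {j : ℤ} (hj : cocycleRel c 0 j) (i : ℕ) (a : Fin (p - 1))
    (ha : ¬(p : ℤ) ∣ (i : ℤ) - a - j) : c j (sBasis K p i) a = 0 := by
  have h := congrFun (LinearMap.congr_fun hj (sBasis K p i)) a
  simp only [sub_zero, zero_add, h0, zero_mul, mul_zero, add_zero, LinearMap.smul_apply,
    Pi.smul_apply, LinearMap.sub_apply, Pi.sub_apply, Module.End.mul_apply, sRho_zero_apply hp,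
    sRho_zero hp, map_smul, smul_eq_mul] at h
  have hne : (((i : ℤ) - a - j : ℤ) : K) ≠ 0 := fun h' =>
    ha ((CharP.intCast_eq_zero_iff K p _).1 h')
  refine (mul_eq_zero.1 ?_).resolve_left hne
  push_cast
  linear_combination -h

theorem weight_sBasis_pred [CharP K p] (hp : p.Prime) {c : ℤ → Module.End K (Fin (p - 1) → K)}
    (h0 : c 0 = 0) (j : ℕ) (hj : cocycleRel c 0 ((j + 1 : ℕ) : ℤ)) :
    c ((j + 1 : ℕ) : ℤ) (sBasis K p j) = 0 := by
  funext a
  refine weight_apply hp h0 hj j a fun h => ?_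
  have := a.2
  rw [show (j : ℤ) - a - ((j + 1 : ℕ) : ℤ) = -((a : ℕ) + 1 : ℤ) by push_cast; ring, dvd_neg] at h
  have := Int.le_of_dvd (by omega) h
  omega

theorem eq_zero_of_commute_neg_one {X : Module.End K (Fin (p - 1) → K)}
    (hX : sRho K p (-1) * X = X * sRho K p (-1)) {n : ℕ} (hn : X (sBasis K p n) = 0) {i : ℕ}
    (hi : n ≤ i) : X (sBasis K p i) = 0 := by
  induction i, hi using Nat.le_induction with
  | base => exact hn
  | succ i _ ih =>
    have := LinearMap.congr_fun hX (sBasis K p i)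
    rwa [Module.End.mul_apply, Module.End.mul_apply, ih, map_zero, sRho_neg_one, eq_comm] at this

theorem natCast_ne_zero_of_lt [CharP K p] {n : ℕ} (h0 : 0 < n) (hn : n < p) : (n : K) ≠ 0 :=
  fun h => absurd (Nat.le_of_dvd h0 ((CharP.cast_eq_zero_iff K p n).1 h)) (by omega)

theorem IsReducedCocycle.eq_zero [CharP K p] (hp : p.Prime) (hp3 : 3 < p)
    {c : ℤ → Module.End K (Fin (p - 1) → K)} (hc : IsReducedCocycle c)
    (hm : c (-1) = 0) (h0 : c 0 = 0) : c = 0 := by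
  have h1 : c 1 = 0 := by
    have hcomm := hc.neg_one_one
    simp only [cocycleRel, hm, h0, neg_add_cancel, smul_zero, zero_mul, mul_zero, add_zero,
      sub_zero] at hcomm
    have hz := weight_sBasis_pred hp h0 0 (hc.zero_natCast 1 (by norm_num))
    refine ext_sBasis fun i => ?_
    exact eq_zero_of_commute_neg_one (sub_eq_zero.1 hcomm.symm) hz (Nat.zero_le i)
  have h2 : ∀ i, 1 ≤ i → c 2 (sBasis K p i) = 0 := by
    intro i hi
    have hcomm := hc.neg_one_two
    simp only [cocycleRel, hm, zero_mul, mul_zero, add_zero, sub_zero,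
      show (-1 : ℤ) + 2 = 1 by norm_num, h1, smul_zero] at hcomm
    have hz := weight_sBasis_pred hp h0 1 (hc.zero_natCast 2 le_rfl)
    exact eq_zero_of_commute_neg_one (sub_eq_zero.1 hcomm.symm) hz hi
  have step : ∀ n : ℕ, n + 4 ≤ p → ((n + 1 : ℕ) : K) • c ((n + 3 : ℕ) : ℤ) =
      sRho K p 1 * c ((n + 2 : ℕ) : ℤ) - c ((n + 2 : ℕ) : ℤ) * sRho K p 1 := by
    intro n hn
    have h := hc.one_natCast (n + 2) (by omega)
    simp only [cocycleRel, h1, zero_mul, mul_zero, add_zero, sub_zero] at h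
    rw [← h, show (1 : ℤ) + ((n + 2 : ℕ) : ℤ) = ((n + 3 : ℕ) : ℤ) by push_cast; ring]
    congr 1
    push_cast
    ring
  have high : ∀ n : ℕ, n + 3 ≤ p → ∀ i, n + 1 ≤ i → c ((n + 2 : ℕ) : ℤ) (sBasis K p i) = 0 := by
    intro n
    induction n with
    | zero => intro _ i hi; exact h2 i hi
    | succ n ih =>
      intro hn i hi
      have h := LinearMap.congr_fun (step n (by omega)) (sBasis K p i)
      rw [LinearMap.smul_apply, LinearMap.sub_apply, Module.End.mul_apply, Module.End.mul_apply,
        sRho_one hp, map_smul, ih (by omega) i (by omega), ih (by omega) (i - 1) (by omega),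
        map_zero, smul_zero, sub_zero] at h
      exact (smul_eq_zero.1 h).resolve_left (natCast_ne_zero_of_lt (by omega) (by omega))
  have edge : ∀ n : ℕ, n + 3 ≤ p → c ((n + 2 : ℕ) : ℤ) (sBasis K p n) = 0 →
      c 2 (sBasis K p 0) = 0 := by
    intro n
    induction n with
    | zero => intro _ h; exact h
    | succ n ih =>
      intro hn hz
      refine ih (by omega) ?_
      have h := LinearMap.congr_fun (step n (by omega)) (sBasis K p (n + 1))
      rw [LinearMap.smul_apply, LinearMap.sub_apply, Module.End.mul_apply, Module.End.mul_apply,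
        sRho_one hp, map_smul, high n (by omega) (n + 1) le_rfl, map_zero, zero_sub,
        show n + 1 - 1 = n by omega, hz, smul_zero, eq_comm, neg_eq_zero] at h
      refine (smul_eq_zero.1 h).resolve_left (mul_ne_zero ?_ ?_)
      · have := natCast_ne_zero_of_lt (K := K) (n := n + 2) (p := p) (by omega) (by omega)
        intro h'
        apply this
        push_cast at h' ⊢
        linear_combination h'
      · exact natCast_ne_zero_of_lt (by omega) (by omega)
  have h20 : c 2 (sBasis K p 0) = 0 := by
    obtain ⟨n, rfl⟩ : ∃ n, p = n + 4 := ⟨p - 4, by omega⟩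
    refine edge n (by omega) ?_
    have h := LinearMap.congr_fun (step n le_rfl) (sBasis K (n + 4) (n + 1))
    rw [hc.supp _ (Or.inr (by push_cast; omega)), smul_zero, LinearMap.zero_apply,
      LinearMap.sub_apply, Module.End.mul_apply, Module.End.mul_apply,
      sRho_one hp, map_smul, high n (by omega) (n + 1) le_rfl, map_zero, zero_sub,
      show n + 1 - 1 = n by omega, eq_comm, neg_eq_zero] at h
    refine (smul_eq_zero.1 h).resolve_left (mul_ne_zero ?_ ?_)
    · have := natCast_ne_zero_of_lt (K := K) (n := n + 2) (p := n + 4) (by omega) (by omega)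
      intro h'
      apply this
      push_cast at h' ⊢
      linear_combination h'
    · exact natCast_ne_zero_of_lt (p := n + 4) (by omega) (by omega)
  have all : ∀ n : ℕ, n + 4 ≤ p → c ((n + 2 : ℕ) : ℤ) = 0 := by
    intro n
    induction n with
    | zero =>
      intro _
      refine ext_sBasis fun i => ?_
      rcases Nat.eq_zero_or_pos i with rfl | hi
      · exact h20
      · exact h2 i hi
    | succ n ih =>
      intro hn
      have h := step n (by omega)
      rw [ih (by omega), zero_mul, mul_zero, sub_zero] at h
      exact (smul_eq_zero.1 h).resolve_left (natCast_ne_zero_of_lt (by omega) (by omega))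
  funext k
  by_cases hk : k < -1 ∨ (p : ℤ) - 2 < k
  · exact hc.supp k hk
  · by_cases hk2 : k < 2
    · obtain rfl | rfl | rfl : k = -1 ∨ k = 0 ∨ k = 1 := by omega
      exacts [hm, h0, h1]
    · obtain ⟨n, rfl⟩ : ∃ n : ℕ, k = ((n + 2 : ℕ) : ℤ) := ⟨(k - 2).toNat, by omega⟩
      exact all n (by omega)

/-- Since `e_0` acts semisimply on every restricted extension, `c` is a coboundary on `e_0`. -/
theorem exists_sCob_zero_eq [CharP K p] (hp : p.Prime) {X : Module.End K (Fin (p - 1) → K)}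
    (hX : ∑ k ∈ Finset.range p, sRho K p 0 ^ k * X * sRho K p 0 ^ (p - 1 - k) = X) :
    ∃ f, sCob f 0 = X := by
  have entry : ∀ i : Fin (p - 1), X (sBasis K p i) i = 0 := by
    intro i
    have h := congrFun (LinearMap.congr_fun hX (sBasis K p i)) i
    rw [LinearMap.sum_apply, Finset.sum_apply, Finset.sum_congr rfl (g := fun _ =>
      (-(((i : ℕ) : K) + 1)) ^ (p - 1) * X (sBasis K p i) i)] at h
    · simpa using h.symm
    · intro k hk
      have hk := Finset.mem_range.1 hk
      rw [Module.End.mul_apply, Module.End.mul_apply, sRho_zero_pow_apply hp,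
        sRho_zero_pow_sBasis hp, map_smul, Pi.smul_apply, smul_eq_mul, ← mul_assoc, ← pow_add,
        show k + (p - 1 - k) = p - 1 by omega]
  refine ⟨Matrix.toLin' (Matrix.of fun a i : Fin (p - 1) =>
    X (sBasis K p i) a / (((i : ℕ) : K) - (a : ℕ))), ext_sBasis fun i => ?_⟩
  by_cases hi : i < p - 1
  · funext a
    have hf := toLin'_sBasis (Matrix.of fun a i : Fin (p - 1) =>
      X (sBasis K p i) a / (((i : ℕ) : K) - (a : ℕ))) ⟨i, hi⟩ a
    simp only [Matrix.of_apply] at hf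
    rw [sCob, LinearMap.sub_apply, Module.End.mul_apply, Module.End.mul_apply, Pi.sub_apply,
      sRho_zero_apply hp, sRho_zero hp, map_smul, Pi.smul_apply, smul_eq_mul, hf, ← sub_mul]
    by_cases ha : (a : ℕ) = i
    · subst ha
      simp [entry]
    · have hne : (i : K) - (a : ℕ) ≠ 0 := by
        intro h
        have h' : ((i : ℤ) - (a : ℕ) : ℤ) = 0 := by
          refine Int.eq_zero_of_abs_lt_dvd
            ((CharP.intCast_eq_zero_iff K p _).1 (by push_cast; exact h)) ?_
          have := a.2
          rw [abs_lt]
          omega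
        omega
      field_simp
      ring
  · simp [sBasis_eq_zero (not_lt.1 hi)]

/-- A weight-`(-1)` operator is the coboundary at `e_{-1}` of a diagonal operator. -/
theorem IsReducedCocycle.exists_sCob_neg_one_eq [CharP K p] (hp : p.Prime)
    {c : ℤ → Module.End K (Fin (p - 1) → K)} (hc : IsReducedCocycle c) (h0 : c 0 = 0) :
    ∃ f : Module.End K (Fin (p - 1) → K), sCob f 0 = 0 ∧ sCob f (-1) = c (-1) := by
  set y : ℕ → K := fun k => if h : k + 1 < p - 1 then c (-1) (sBasis K p k) ⟨k + 1, h⟩ else 0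
    with hy
  have hcy : ∀ i, i < p - 1 → c (-1) (sBasis K p i) = y i • sBasis K p (i + 1) := by
    intro i hi
    funext a
    rw [Pi.smul_apply, sBasis_apply, smul_eq_mul]
    by_cases ha : (a : ℕ) = i + 1
    · have h : i + 1 < p - 1 := ha ▸ a.2
      obtain rfl : a = ⟨i + 1, h⟩ := Fin.ext ha
      simp [hy, h]
    · rw [if_neg ha, mul_zero]
      refine weight_apply hp h0 hc.zero_neg_one i a fun h => ?_
      have := a.2
      have : (i : ℤ) - a - -1 = 0 := by
        refine Int.eq_zero_of_abs_lt_dvd h ?_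
        rw [abs_lt]
        omega
      omega
  set f : Module.End K (Fin (p - 1) → K) := Matrix.toLin' (Matrix.diagonal fun i : Fin (p - 1) =>
    -∑ k ∈ Finset.range i, y k) with hf_def
  have hf : ∀ i, f (sBasis K p i) = (-∑ k ∈ Finset.range i, y k) • sBasis K p i := by
    intro i
    by_cases hi : i < p - 1
    · funext a
      have h := toLin'_sBasis (Matrix.diagonal fun i : Fin (p - 1) =>
        -∑ k ∈ Finset.range i, y k) ⟨i, hi⟩ a
      rw [hf_def, h, Matrix.diagonal_apply, Pi.smul_apply, sBasis_apply]
      simp only [Fin.ext_iff]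
      split_ifs with ha <;> simp [ha]
    · rw [sBasis_eq_zero (not_lt.1 hi), map_zero, smul_zero]
  refine ⟨f, ext_sBasis fun i => ?_, ext_sBasis fun i => ?_⟩
  · simp only [sCob, LinearMap.sub_apply, Module.End.mul_apply, sRho_zero hp, hf, map_smul,
      LinearMap.zero_apply]
    module
  · by_cases hi : i < p - 1
    · simp only [sCob, LinearMap.sub_apply, Module.End.mul_apply, sRho_neg_one, hf, map_smul,
        hcy i hi, Finset.sum_range_succ]
      module
    · simp [sBasis_eq_zero (not_lt.1 hi)]

theorem cocycleRel_of_mem_cocycles {c : ℤ → Module.End K (Fin (p - 1) → K)}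
    (hc : c ∈ cocycles K p (-1) (sRho K p) (sRho K p)) {i j : ℤ}
    (hij : -1 ≤ i ∧ i ≤ (p : ℤ) - 2 ∧ -1 ≤ j ∧ j ≤ (p : ℤ) - 2) : cocycleRel c i j := by
  simp only [cocycles, Submodule.mem_inf, Submodule.mem_iInf, LinearMap.mem_ker] at hc
  have h := hc.1.2 i j
  rw [bracketConstraint, if_pos hij] at h
  refine LinearMap.ext fun v => ?_
  have h' := LinearMap.congr_fun h v
  simp only [LinearMap.add_apply, LinearMap.sub_apply, LinearMap.smul_apply, LinearMap.comp_apply,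
    LinearMap.proj_apply, LinearMap.llcomp_apply, LinearMap.lcomp_apply,
    LinearMap.zero_apply] at h'
  simp only [LinearMap.add_apply, LinearMap.sub_apply, LinearMap.smul_apply, Module.End.mul_apply]
  rw [← sub_eq_zero, ← h']
  abel

theorem isReducedCocycle_of_mem_cocycles (hp3 : 3 < p)
    {c : ℤ → Module.End K (Fin (p - 1) → K)}
    (hc : c ∈ cocycles K p (-1) (sRho K p) (sRho K p)) : IsReducedCocycle c where
  supp k hk := by
    simp only [cocycles, Submodule.mem_inf, Submodule.mem_iInf, LinearMap.mem_ker] at hc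
    have h := hc.1.1 k
    rwa [suppConstraint, if_pos hk] at h
  zero_neg_one := cocycleRel_of_mem_cocycles hc (by omega)
  zero_natCast j hj := cocycleRel_of_mem_cocycles hc (by omega)
  neg_one_one := cocycleRel_of_mem_cocycles hc (by omega)
  neg_one_two := cocycleRel_of_mem_cocycles hc (by omega)
  one_natCast j hj := cocycleRel_of_mem_cocycles hc (by omega)

theorem sum_sRho_zero_of_mem_cocycles (hp3 : 3 < p)
    {c : ℤ → Module.End K (Fin (p - 1) → K)}
    (hc : c ∈ cocycles K p (-1) (sRho K p) (sRho K p)) :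
    ∑ k ∈ Finset.range p, sRho K p 0 ^ k * c 0 * sRho K p 0 ^ (p - 1 - k) = c 0 := by
  simp only [cocycles, Submodule.mem_inf, Submodule.mem_iInf, LinearMap.mem_ker] at hc
  have h := hc.2 0
  rw [pcharConstraint, if_pos (by omega), if_pos rfl, LinearMap.sub_apply, sub_eq_zero,
    LinearMap.sum_apply] at h
  exact h

theorem mem_coboundaries_of_eq_sCob (hp3 : 3 < p) {c : ℤ → Module.End K (Fin (p - 1) → K)}
    (f : Module.End K (Fin (p - 1) → K)) (hf : ∀ k, c k = sCob f k) :
    c ∈ coboundaries K p (-1) (sRho K p) (sRho K p) := by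
  refine ⟨f, funext fun k => ?_⟩
  rw [hf, LinearMap.pi_apply]
  split_ifs with hk
  · rfl
  · rw [sCob, sRho_eq_zero (by omega) hp3, zero_mul, mul_zero, sub_zero, LinearMap.zero_apply]

end SimpleModule

/-- For `χ = 0`, `Ext(S, S) = 0` in the category of restricted `W`-modules: every
short exact sequence `0 → S → M → S → 0` of restricted `W`-modules splits
(every cocycle is a coboundary). -/
theorem ext_S_S_eq_zero
    (K : Type) [Field K] [IsAlgClosed K] (p : ℕ) [CharP K p] (hp : 3 < p)
    :
    cocycles K p (-1) (sRho K p) (sRho K p) ≤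
      coboundaries K p (-1) (sRho K p) (sRho K p) := by
  have hprime : p.Prime := (CharP.char_is_prime_or_zero K p).resolve_right (by omega)
  intro c hc
  obtain ⟨f, hf⟩ := exists_sCob_zero_eq hprime (sum_sRho_zero_of_mem_cocycles hp hc)
  have hc1 := (isReducedCocycle_of_mem_cocycles hp hc).sub_sCob hprime hp f
  obtain ⟨g, hg0, hg1⟩ := hc1.exists_sCob_neg_one_eq hprime (by rw [hf, sub_self])
  have hz := (hc1.sub_sCob hprime hp g).eq_zero hprime hp (by rw [hg1, sub_self])
    (by rw [hg0, hf, sub_self, sub_zero])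
  refine mem_coboundaries_of_eq_sCob hp (f + g) fun k => ?_
  have h := congrFun hz k
  rw [Pi.zero_apply, sub_sub, sub_eq_zero] at h
  rw [h, sCob, sCob, sCob, mul_add, add_mul]
  abel
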